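/- For all α, ε ∈ (0,1) there exists η0 > 0 such that for every η ∈ (0, η0] there exists n0 ∈ ℕ with the following property: for every n ≥ n0, if H is an n-vertex linear hypergraph such that every edge e satisfies 1/η ≤ |e| ≤ η√n, and min_{e∈H}|e| ≥ α·max_{e∈H}|e|, then the chromatic index of H is at most εn. -/

import Mathlib

open Finset
open scoped Classical

/-- A hypergraph on vertex set `Fin n` is *linear* if any two distinct edges intersect in at
most one vertex. -/
def LinearHG {n : ℕ} (H : Finset (Finset (Fin n))) : Prop :=
  ∀ e ∈ H, ∀ f ∈ H, e ≠ f → (e ∩ f).card ≤ 1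

/-- `φ` is a proper edge-colouring of the hypergraph `H`. -/
def IsProperEC {n : ℕ} (H : Finset (Finset (Fin n))) (φ : Finset (Fin n) → ℕ) : Prop :=
  ∀ e ∈ H, ∀ f ∈ H, e ≠ f → (e ∩ f).Nonempty → φ e ≠ φ f

/-- The chromatic index of the hypergraph `H` is at most `k`. -/
def ChromIndexLE {n : ℕ} (H : Finset (Finset (Fin n))) (k : ℕ) : Prop :=
  ∃ φ : Finset (Fin n) → ℕ, (∀ e ∈ H, φ e < k) ∧ IsProperEC H φ


section HardCore

variable {V : Type*} [DecidableEq V] (G : SimpleGraph V)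

/-- The independent sets of `G` contained in `U`. -/
noncomputable def indepFamily (U : Finset V) : Finset (Finset V) :=
  U.powerset.filter fun I => G.IsIndepSet (I : Set V)

/-- The partition function of the hard-core model on `G[U]` with fugacity `l`. -/
noncomputable def hardCoreZ (l : ℝ) (U : Finset V) : ℝ :=
  ∑ I ∈ indepFamily G U, l ^ #I

/-- The vertices of `U` which are neither equal nor adjacent to `v`. -/
noncomputable def deleteClosedNbhd (U : Finset V) (v : V) : Finset V :=
  U.filter fun x => x ≠ v ∧ ¬ G.Adj v x

/-- The total weight of the independent sets of `G[U]` containing `v`. -/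
noncomputable def hardCoreAt (l : ℝ) (U : Finset V) (v : V) : ℝ :=
  ∑ I ∈ (indepFamily G U).filter (fun I => v ∈ I), l ^ #I

variable {G}

lemma mem_indepFamily {U I : Finset V} :
    I ∈ indepFamily G U ↔ I ⊆ U ∧ ∀ x ∈ I, ∀ y ∈ I, ¬ G.Adj x y := by
  simp only [indepFamily, mem_filter, mem_powerset, SimpleGraph.isIndepSet_iff, Set.Pairwise,
    mem_coe]
  refine and_congr_right fun _ => ⟨fun h x hx y hy hxy => ?_, fun h x hx y hy _ => h x hx y hy⟩
  exact h hx hy hxy.ne hxy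

lemma mem_deleteClosedNbhd {U : Finset V} {v x : V} :
    x ∈ deleteClosedNbhd G U v ↔ x ∈ U ∧ x ≠ v ∧ ¬ G.Adj v x := by
  simp [deleteClosedNbhd]

lemma indepFamily_mono {U W : Finset V} (h : U ⊆ W) : indepFamily G U ⊆ indepFamily G W :=
  fun _ hI => mem_indepFamily.2 ⟨(mem_indepFamily.1 hI).1.trans h, (mem_indepFamily.1 hI).2⟩

lemma empty_mem_indepFamily (U : Finset V) : ∅ ∈ indepFamily G U :=
  mem_indepFamily.2 (by simp)

variable {l : ℝ}

lemma one_le_hardCoreZ (hl : 0 < l) (U : Finset V) : 1 ≤ hardCoreZ G l U := by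
  have := single_le_sum (f := fun I : Finset V => l ^ #I) (fun I _ => by positivity)
    (empty_mem_indepFamily (G := G) U)
  simpa [hardCoreZ] using this

lemma hardCoreZ_mono (hl : 0 < l) {U W : Finset V} (h : U ⊆ W) :
    hardCoreZ G l U ≤ hardCoreZ G l W :=
  sum_le_sum_of_subset_of_nonneg (indepFamily_mono h) fun _ _ _ => by positivity

lemma hardCoreZ_le_exp (hl : 0 < l) (U : Finset V) : hardCoreZ G l U ≤ Real.exp (l * #U) := by
  calc hardCoreZ G l U ≤ ∑ I ∈ U.powerset, l ^ #I :=
        sum_le_sum_of_subset_of_nonneg (filter_subset _ _) fun _ _ _ => by positivity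
    _ = (l + 1) ^ #U := by
        rw [← sum_pow_mul_eq_add_pow]; simp
    _ ≤ Real.exp l ^ #U := by
        gcongr
        exact Real.add_one_le_exp l
    _ = Real.exp (l * #U) := by rw [mul_comm, Real.exp_nat_mul]

lemma hardCoreAt_eq {U : Finset V} {v : V} (hv : v ∈ U) :
    hardCoreAt G l U v = l * hardCoreZ G l (deleteClosedNbhd G U v) := by
  rw [hardCoreAt, hardCoreZ, mul_sum]
  refine sum_bij' (fun I _ => I.erase v) (fun I _ => insert v I) ?_ ?_ ?_ ?_ ?_
  · intro I hI
    simp only [mem_filter, mem_indepFamily] at hI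
    obtain ⟨⟨hIU, hI⟩, hvI⟩ := hI
    refine mem_indepFamily.2 ⟨fun x hx => ?_, fun x hx y hy => ?_⟩
    · rw [mem_erase] at hx
      exact mem_deleteClosedNbhd.2 ⟨hIU hx.2, hx.1, hI v hvI x hx.2⟩
    · exact hI x (mem_of_mem_erase hx) y (mem_of_mem_erase hy)
  · intro I hI
    obtain ⟨hIU, hI⟩ := mem_indepFamily.1 hI
    simp only [mem_filter, mem_indepFamily, mem_insert_self, and_true]
    refine ⟨fun x hx => ?_, fun x hx y hy => ?_⟩
    · rcases mem_insert.1 hx with h | h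
      · exact h ▸ hv
      · exact (mem_deleteClosedNbhd.1 (hIU h)).1
    · rcases mem_insert.1 hx with h | h <;> rcases mem_insert.1 hy with h' | h'
      · exact h ▸ h' ▸ G.loopless.irrefl _
      · exact h ▸ (mem_deleteClosedNbhd.1 (hIU h')).2.2
      · exact fun hadj => (mem_deleteClosedNbhd.1 (hIU h)).2.2 (h' ▸ hadj.symm)
      · exact hI x h y h'
  · intro I hI
    exact insert_erase (mem_filter.1 hI).2
  · intro I hI
    refine erase_insert fun h => ?_
    exact (mem_deleteClosedNbhd.1 ((mem_indepFamily.1 hI).1 h)).2.1 rfl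
  · intro I hI
    rw [← card_erase_add_one (mem_filter.1 hI).2, pow_succ, mul_comm]

lemma hardCoreAt_le (hl : 0 < l) {U : Finset V} {v : V} (hv : v ∈ U) :
    hardCoreAt G l U v ≤ l * hardCoreZ G l U := by
  rw [hardCoreAt_eq hv]
  gcongr
  exact hardCoreZ_mono hl (filter_subset _ _)

lemma hardCoreAt_pos (hl : 0 < l) {U : Finset V} {v : V} (hv : v ∈ U) :
    0 < hardCoreAt G l U v := by
  rw [hardCoreAt_eq hv]
  have := one_le_hardCoreZ (G := G) hl (deleteClosedNbhd G U v)
  positivity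

lemma hardCoreZ_le_delete (hl : 0 < l) (U : Finset V) (v : V) :
    hardCoreZ G l U ≤ hardCoreZ G l (deleteClosedNbhd G U v)
      + l * #(U.filter fun x => x = v ∨ G.Adj v x) * hardCoreZ G l U := by
  set T := U.filter fun x => x = v ∨ G.Adj v x with hT
  have hsub : indepFamily G U ⊆ indepFamily G (deleteClosedNbhd G U v) ∪
      T.biUnion fun t => (indepFamily G U).filter fun I => t ∈ I := by
    intro I hI
    rw [mem_union, or_iff_not_imp_left]
    intro hI'
    obtain ⟨hIU, hind⟩ := mem_indepFamily.1 hI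
    have : ¬ I ⊆ deleteClosedNbhd G U v := fun h => hI' (mem_indepFamily.2 ⟨h, hind⟩)
    obtain ⟨t, htI, ht⟩ := not_subset.1 this
    rw [mem_biUnion]
    refine ⟨t, ?_, mem_filter.2 ⟨hI, htI⟩⟩
    rw [hT, mem_filter]
    refine ⟨hIU htI, ?_⟩
    rw [mem_deleteClosedNbhd] at ht
    have := hIU htI
    tauto
  have hnn : ∀ I : Finset V, 0 ≤ l ^ #I := fun I => by positivity
  calc hardCoreZ G l U ≤ ∑ I ∈ indepFamily G (deleteClosedNbhd G U v) ∪
        T.biUnion (fun t => (indepFamily G U).filter fun I => t ∈ I), l ^ #I :=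
        sum_le_sum_of_subset_of_nonneg hsub fun _ _ _ => hnn _
    _ ≤ hardCoreZ G l (deleteClosedNbhd G U v) + ∑ I ∈ T.biUnion
        (fun t => (indepFamily G U).filter fun I => t ∈ I), l ^ #I := by
        rw [hardCoreZ, ← sum_union_inter]
        exact le_add_of_nonneg_right (sum_nonneg fun _ _ => hnn _)
    _ ≤ hardCoreZ G l (deleteClosedNbhd G U v) + ∑ t ∈ T, hardCoreAt G l U t := by
        gcongr
        simp only [hardCoreAt, sum_filter]
        rw [sum_comm]
        have hbi : T.biUnion (fun t => (indepFamily G U).filter fun I => t ∈ I) ⊆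
            indepFamily G U := biUnion_subset.2 fun t _ => filter_subset _ _
        refine (sum_le_sum fun I hI => ?_).trans
          (sum_le_sum_of_subset_of_nonneg hbi fun I _ _ =>
            sum_nonneg fun t _ => by split_ifs <;> simp [hnn])
        obtain ⟨t, ht, hI⟩ := mem_biUnion.1 hI
        have h := single_le_sum (f := fun t => if t ∈ I then l ^ #I else 0)
          (fun t _ => by split_ifs <;> simp [hnn]) ht
        simpa [(mem_filter.1 hI).2] using h
    _ ≤ hardCoreZ G l (deleteClosedNbhd G U v) + ∑ t ∈ T, l * hardCoreZ G l U := by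
        gcongr with t ht
        exact hardCoreAt_le hl (mem_filter.1 ht).1
    _ = _ := by
        rw [sum_const, nsmul_eq_mul]; ring

lemma sum_hardCoreAt (U P : Finset V) :
    ∑ u ∈ P, hardCoreAt G l U u = ∑ I ∈ indepFamily G U, l ^ #I * #(P ∩ I) := by
  simp only [hardCoreAt, sum_filter]
  rw [sum_comm]
  refine sum_congr rfl fun I _ => ?_
  rw [← sum_filter, sum_const, nsmul_eq_mul, mul_comm, filter_mem_eq_inter]

/-- If every vertex of `J` has few neighbours in `J`, then the expected size of a random
independent subset of `J` is of order `l * #J`. -/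
lemma hardCore_mean_lower (hl : 0 < l) {J : Finset V} {d : ℝ}
    (hd : ∀ u ∈ J, (#(J.filter fun x => G.Adj u x) : ℝ) ≤ d) (hld : l * (d + 1) ≤ 1 / 2) :
    l * #J / 2 * hardCoreZ G l J ≤ ∑ I ∈ indepFamily G J, l ^ #I * #I := by
  have h1 : ∑ I ∈ indepFamily G J, l ^ #I * (#I : ℝ) = ∑ u ∈ J, hardCoreAt G l J u := by
    rw [sum_hardCoreAt]
    refine sum_congr rfl fun I hI => ?_
    rw [inter_eq_right.2 (mem_indepFamily.1 hI).1]
  rw [h1]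
  have h2 : ∀ u ∈ J, l / 2 * hardCoreZ G l J ≤ hardCoreAt G l J u := by
    intro u hu
    rw [hardCoreAt_eq hu]
    have hZ := one_le_hardCoreZ (G := G) hl J
    have h3 := hardCoreZ_le_delete (G := G) hl J u
    have h4 : (#(J.filter fun x => x = u ∨ G.Adj u x) : ℝ) ≤ d + 1 := by
      have : J.filter (fun x => x = u ∨ G.Adj u x) ⊆
          insert u (J.filter fun x => G.Adj u x) := by
        intro x hx
        simp only [mem_filter, mem_insert] at hx ⊢
        tauto
      have h5 := (card_le_card this).trans (card_insert_le _ _)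
      have h6 : (#(J.filter fun x => x = u ∨ G.Adj u x) : ℝ) ≤
          #(J.filter fun x => G.Adj u x) + 1 := by exact_mod_cast h5
      linarith [hd u hu]
    have h5 : l * #(J.filter fun x => x = u ∨ G.Adj u x) * hardCoreZ G l J ≤
        1 / 2 * hardCoreZ G l J := by
      gcongr
      exact (mul_le_mul_of_nonneg_left h4 hl.le).trans hld
    nlinarith
  calc l * #J / 2 * hardCoreZ G l J = ∑ u ∈ J, l / 2 * hardCoreZ G l J := by
        rw [sum_const, nsmul_eq_mul]; ring
    _ ≤ _ := sum_le_sum h2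

/-- The vertices of `P` without neighbours in `W`. -/
noncomputable def unblocked (G : SimpleGraph V) (P W : Finset V) : Finset V :=
  P.filter fun x => ∀ y ∈ W, ¬ G.Adj x y

/-- An independent set avoiding `v` splits into its trace outside the closed neighbourhood of `v`
and an independent set of unblocked neighbours of `v`. -/
lemma sum_indepFamily_not_mem (U : Finset V) (v : V) (g : ℕ → ℝ) :
    ∑ I ∈ (indepFamily G U).filter (fun I => v ∉ I),
        l ^ #I * g #(U.filter (fun x => G.Adj v x) ∩ I) =
      ∑ W ∈ indepFamily G (deleteClosedNbhd G U v), l ^ #W *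
        ∑ S ∈ indepFamily G (unblocked G (U.filter fun x => G.Adj v x) W), l ^ #S * g #S := by
  simp only [mul_sum]
  rw [sum_sigma']
  refine sum_bij' (fun I _ => ⟨I.filter fun x => ¬ G.Adj v x, I.filter fun x => G.Adj v x⟩)
    (fun p _ => p.1 ∪ p.2) ?_ ?_ ?_ ?_ ?_
  · intro I hI
    rw [mem_filter, mem_indepFamily] at hI
    obtain ⟨⟨hIU, hind⟩, hvI⟩ := hI
    rw [mem_sigma]
    refine ⟨mem_indepFamily.2 ⟨fun x hx => ?_, fun x hx y hy => ?_⟩,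
      mem_indepFamily.2 ⟨fun x hx => ?_, fun x hx y hy => ?_⟩⟩
    · rw [mem_filter] at hx
      exact mem_deleteClosedNbhd.2 ⟨hIU hx.1, fun h => hvI (h ▸ hx.1), hx.2⟩
    · exact hind x (mem_filter.1 hx).1 y (mem_filter.1 hy).1
    · rw [mem_filter] at hx
      exact mem_filter.2 ⟨mem_filter.2 ⟨hIU hx.1, hx.2⟩,
        fun y hy => hind x hx.1 y (mem_filter.1 hy).1⟩
    · exact hind x (mem_filter.1 hx).1 y (mem_filter.1 hy).1
  · rintro ⟨W, S⟩ hp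
    rw [mem_sigma, mem_indepFamily, mem_indepFamily] at hp
    obtain ⟨⟨hWU, hW⟩, hSU, hS⟩ := hp
    dsimp only at hWU hW hSU hS ⊢
    rw [mem_filter, mem_indepFamily]
    have hSW : ∀ x ∈ S, ∀ y ∈ W, ¬ G.Adj x y := fun x hx => (mem_filter.1 (hSU hx)).2
    refine ⟨⟨?_, ?_⟩, ?_⟩
    · refine union_subset (hWU.trans (filter_subset _ _)) ?_
      exact hSU.trans ((filter_subset _ _).trans (filter_subset _ _))
    · intro x hx y hy
      rcases mem_union.1 hx with hx | hx <;> rcases mem_union.1 hy with hy | hy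
      · exact hW x hx y hy
      · exact fun h => hSW y hy x hx h.symm
      · exact hSW x hx y hy
      · exact hS x hx y hy
    · rw [mem_union, not_or]
      refine ⟨fun h => (mem_deleteClosedNbhd.1 (hWU h)).2.1 rfl, fun h => ?_⟩
      exact G.loopless.irrefl v (mem_filter.1 (mem_filter.1 (hSU h)).1).2
  · intro I hI
    rw [mem_filter, mem_indepFamily] at hI
    dsimp only
    rw [union_comm]
    exact filter_union_filter_not_eq _ _
  · rintro ⟨W, S⟩ hp
    rw [mem_sigma, mem_indepFamily, mem_indepFamily] at hp
    obtain ⟨⟨hWU, -⟩, hSU, -⟩ := hp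
    dsimp only at hWU hSU ⊢
    have hWn : ∀ x ∈ W, ¬ G.Adj v x := fun x hx => (mem_deleteClosedNbhd.1 (hWU hx)).2.2
    have hSn : ∀ x ∈ S, G.Adj v x := fun x hx =>
      (mem_filter.1 (mem_filter.1 (hSU hx)).1).2
    have e1 : (W ∪ S).filter (fun x => ¬ G.Adj v x) = W := by
      ext x
      simp only [mem_filter, mem_union]
      have := hWn x
      have := hSn x
      tauto
    have e2 : (W ∪ S).filter (fun x => G.Adj v x) = S := by
      ext x
      simp only [mem_filter, mem_union]
      have := hWn x
      have := hSn x
      tauto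
    rw [e1, e2]
  · intro I hI
    rw [mem_filter, mem_indepFamily] at hI
    obtain ⟨⟨hIU, -⟩, hvI⟩ := hI
    have e1 : U.filter (fun x => G.Adj v x) ∩ I = I.filter fun x => G.Adj v x := by
      ext x
      simp only [mem_inter, mem_filter]
      have := @hIU x
      tauto
    have e2 : #I = #(I.filter fun x => ¬ G.Adj v x) + #(I.filter fun x => G.Adj v x) := by
      rw [add_comm]
      exact (card_filter_add_card_filter_not _).symm
    dsimp only
    rw [e1, ← mul_assoc, ← pow_add, ← e2]

/-- Local occupancy of the hard-core model on a graph in which adjacent vertices have few common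
neighbours. -/
lemma hardCore_local_occupancy (hl : 0 < l) (hl1 : l ≤ 1) {U : Finset V} {d A B : ℝ}
    (hB : 0 < B) (hA : 1 + Real.exp (4 / B) ≤ A * l)
    (hd : ∀ v ∈ U, ∀ u ∈ U, G.Adj v u →
      (#(U.filter fun x => G.Adj v x ∧ G.Adj u x) : ℝ) ≤ d)
    (hld : l * (d + 1) ≤ 1 / 2) {v : V} (hv : v ∈ U) :
    hardCoreZ G l U ≤ A * hardCoreAt G l U v +
      B * ∑ u ∈ U.filter (fun x => G.Adj v x), hardCoreAt G l U u := by
  set P := U.filter fun x => G.Adj v x with hP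
  set Q := deleteClosedNbhd G U v with hQ
  have hsplit : hardCoreZ G l U = hardCoreAt G l U v +
      ∑ I ∈ (indepFamily G U).filter (fun I => v ∉ I), l ^ #I * (fun _ => (1 : ℝ)) #(P ∩ I) := by
    simp only [mul_one]
    exact (sum_filter_add_sum_filter_not _ _ _).symm
  have hocc : ∑ I ∈ (indepFamily G U).filter (fun I => v ∉ I),
      l ^ #I * (fun k : ℕ => (k : ℝ)) #(P ∩ I) ≤ ∑ u ∈ P, hardCoreAt G l U u := by
    rw [sum_hardCoreAt]
    exact sum_le_sum_of_subset_of_nonneg (filter_subset _ _) fun _ _ _ => by positivity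
  have hfib := fun g : ℕ → ℝ => sum_indepFamily_not_mem (G := G) (l := l) U v g
  rw [← hP, ← hQ] at hfib
  rw [hfib fun _ => 1] at hsplit
  rw [hfib fun k => k] at hocc
  have hAt : hardCoreAt G l U v = ∑ W ∈ indepFamily G Q, l ^ #W * l := by
    rw [hardCoreAt_eq hv, hardCoreZ, ← sum_mul, mul_comm]
  have hterm : ∀ W ∈ indepFamily G Q,
      l + hardCoreZ G l (unblocked G P W) ≤ A * l +
        B * ∑ S ∈ indepFamily G (unblocked G P W), l ^ #S * (#S : ℝ) := by
    intro W _
    set J := unblocked G P W with hJ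
    have hJP : J ⊆ P := filter_subset _ _
    have hJd : ∀ u ∈ J, (#(J.filter fun x => G.Adj u x) : ℝ) ≤ d := by
      intro u hu
      have huP := mem_filter.1 (hJP hu)
      refine le_trans ?_ (hd v hv u huP.1 huP.2)
      gcongr
      intro x hx
      rw [mem_filter] at hx
      have := mem_filter.1 (hJP hx.1)
      exact mem_filter.2 ⟨this.1, this.2, hx.2⟩
    have hmean := hardCore_mean_lower hl hJd hld
    have hZ := one_le_hardCoreZ (G := G) hl J
    rcases le_total (4 / B) (l * #J) with h | h
    · have h2 : 2 ≤ B * (l * #J / 2) := by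
        rw [div_le_iff₀ hB] at h
        linarith
      have h3 : 2 * hardCoreZ G l J ≤ B * (l * #J / 2) * hardCoreZ G l J := by gcongr
      have h4 := mul_le_mul_of_nonneg_left hmean hB.le
      have h5 := Real.exp_pos (4 / B)
      linarith
    · have h2 := (hardCoreZ_le_exp (G := G) hl J).trans (Real.exp_le_exp.2 h)
      have h3 : 0 ≤ B * ∑ S ∈ indepFamily G J, l ^ #S * (#S : ℝ) :=
        mul_nonneg hB.le (sum_nonneg fun _ _ => by positivity)
      linarith
  have hsum := sum_le_sum fun W hW => mul_le_mul_of_nonneg_left (hterm W hW)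
    (pow_nonneg hl.le #W)
  simp only [mul_add, sum_add_distrib] at hsum
  have e1 : ∑ W ∈ indepFamily G Q, l ^ #W * (A * l) = A * hardCoreAt G l U v := by
    rw [hAt, mul_sum]
    exact sum_congr rfl fun _ _ => by ring
  have e2 : ∑ W ∈ indepFamily G Q, l ^ #W * (B * ∑ S ∈ indepFamily G (unblocked G P W),
      l ^ #S * (#S : ℝ)) = B * ∑ W ∈ indepFamily G Q, l ^ #W *
        ∑ S ∈ indepFamily G (unblocked G P W), l ^ #S * (#S : ℝ) := by
    rw [mul_sum]
    exact sum_congr rfl fun _ _ => by ring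
  rw [e1, e2, ← hAt] at hsum
  have h3 := mul_le_mul_of_nonneg_left hocc hB.le
  simp only [mul_one] at hsplit
  simp only [hardCoreZ] at hsum hsplit ⊢
  linarith

/-- Greedy fractional colouring, in dual form: a local occupancy bound gives independent sets of
large weight. -/
lemma sum_mul_le_of_local_occupancy {H : Finset V} {w : V → ℝ} (hl : 0 < l) {A B M : ℝ}
    (hB : 0 ≤ B)
    (hocc : ∀ U ⊆ H, ∀ v ∈ U, hardCoreZ G l U ≤ A * hardCoreAt G l U v +
      B * ∑ u ∈ U.filter (fun x => G.Adj v x), hardCoreAt G l U u)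
    (hM : ∀ I ∈ indepFamily G H, ∑ v ∈ I, w v ≤ M)
    (U : Finset V) (hU : U ⊆ H) (b : V → ℝ) (hb : ∀ v ∈ U, 0 ≤ b v) (R : ℝ) (hR : 0 ≤ R)
    (hbR : ∀ v ∈ U, A * b v + B * ∑ u ∈ U.filter (fun x => G.Adj v x), b u ≤ R) :
    ∑ v ∈ U, b v * w v ≤ R * M := by
  have hM0 : 0 ≤ M := by simpa using hM ∅ (empty_mem_indepFamily H)
  induction U using Finset.strongInduction generalizing b R with
  | H U ih =>
    rcases U.eq_empty_or_nonempty with rfl | hne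
    · simpa using mul_nonneg hR hM0
    set Z := hardCoreZ G l U with hZdef
    have hZ : 0 < Z := zero_lt_one.trans_le (one_le_hardCoreZ hl U)
    set y : V → ℝ := fun v => hardCoreAt G l U v / Z with hy
    have hypos : ∀ v ∈ U, 0 < y v := fun v hv => div_pos (hardCoreAt_pos hl hv) hZ
    obtain ⟨v₀, hv₀, hmin⟩ := exists_min_image U (fun v => b v / y v) hne
    set t := b v₀ / y v₀ with ht
    have ht0 : 0 ≤ t := div_nonneg (hb v₀ hv₀) (hypos v₀ hv₀).le
    have htle : ∀ v ∈ U, t * y v ≤ b v := fun v hv =>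
      (le_div_iff₀ (hypos v hv)).1 (hmin v hv)
    have hzero : b v₀ - t * y v₀ = 0 := by
      rw [ht, div_mul_cancel₀ _ (hypos v₀ hv₀).ne', sub_self]
    have hyocc : ∀ v ∈ U, 1 ≤ A * y v + B * ∑ u ∈ U.filter (fun x => G.Adj v x), y u := by
      intro v hv
      have h := hocc U hU v hv
      rw [hy]
      dsimp only
      rw [← sum_div, ← mul_div_assoc, ← mul_div_assoc, ← add_div, le_div_iff₀ hZ, one_mul]
      exact h
    have hnew : ∀ v ∈ U, A * (b v - t * y v) +
        B * ∑ u ∈ U.filter (fun x => G.Adj v x), (b u - t * y u) ≤ R - t := by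
      intro v hv
      rw [sum_sub_distrib, ← mul_sum]
      have h1 := mul_le_mul_of_nonneg_left (hyocc v hv) ht0
      have h2 := hbR v hv
      linarith
    have htR : 0 ≤ R - t := by
      refine le_trans ?_ (hnew v₀ hv₀)
      rw [hzero, mul_zero, zero_add]
      exact mul_nonneg hB (sum_nonneg fun u hu => sub_nonneg.2 (htle u (mem_filter.1 hu).1))
    have hyw : ∑ v ∈ U, y v * w v ≤ M := by
      have h1 : ∑ v ∈ U, hardCoreAt G l U v * w v ≤ Z * M := by
        have h2 : ∑ v ∈ U, hardCoreAt G l U v * w v =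
            ∑ I ∈ indepFamily G U, l ^ #I * ∑ v ∈ I, w v := by
          simp only [hardCoreAt, sum_filter, sum_mul]
          rw [sum_comm]
          refine sum_congr rfl fun I hI => ?_
          rw [mul_sum]
          simp only [ite_mul, zero_mul]
          rw [← sum_filter, filter_mem_eq_inter, inter_eq_right.2 (mem_indepFamily.1 hI).1]
        rw [h2, hZdef, hardCoreZ, sum_mul]
        refine sum_le_sum fun I hI => ?_
        gcongr
        exact hM I (indepFamily_mono hU hI)
      have h3 : ∑ v ∈ U, y v * w v = (∑ v ∈ U, hardCoreAt G l U v * w v) / Z := by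
        rw [sum_div]
        exact sum_congr rfl fun v _ => by rw [hy]; ring
      rw [h3, div_le_iff₀ hZ, mul_comm M]
      exact h1
    have hrec := ih (U.erase v₀) (erase_ssubset hv₀) ((erase_subset _ _).trans hU)
      (fun v => b v - t * y v) (fun v hv => sub_nonneg.2 (htle v (mem_of_mem_erase hv)))
      (R - t) htR (by
        intro v hv
        refine le_trans ?_ (hnew v (mem_of_mem_erase hv))
        gcongr _ + B * ?_
        refine sum_le_sum_of_subset_of_nonneg (filter_subset_filter _ (erase_subset _ _)) ?_
        exact fun u hu _ => sub_nonneg.2 (htle u (mem_filter.1 hu).1))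
    have hsum : ∑ v ∈ U, b v * w v = t * ∑ v ∈ U, y v * w v +
        ∑ v ∈ U.erase v₀, (b v - t * y v) * w v := by
      have h1 : ∑ v ∈ U.erase v₀, (b v - t * y v) * w v = ∑ v ∈ U, (b v - t * y v) * w v := by
        refine sum_erase U ?_
        rw [hzero, zero_mul]
      rw [h1, mul_sum, ← sum_add_distrib]
      exact sum_congr rfl fun v _ => by ring
    rw [hsum]
    have := mul_le_mul_of_nonneg_left hyw ht0
    linarith

/-- A graph with bounded degree in which adjacent vertices have few common neighbours has
independent sets of large weight, for every weight function. -/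
lemma exists_indep_large_weight {H : Finset V} {d D A B : ℝ} (hl : 0 < l) (hl1 : l ≤ 1)
    (hA0 : 0 ≤ A) (hB : 0 < B) (hD : 0 ≤ D) (hA : 1 + Real.exp (4 / B) ≤ A * l)
    (hdeg : ∀ v ∈ H, (#(H.filter fun x => G.Adj v x) : ℝ) ≤ D)
    (hd : ∀ v ∈ H, ∀ u ∈ H, G.Adj v u →
      (#(H.filter fun x => G.Adj v x ∧ G.Adj u x) : ℝ) ≤ d)
    (hld : l * (d + 1) ≤ 1 / 2) (w : V → ℝ) :
    ∃ I ∈ indepFamily G H, ∑ v ∈ H, w v ≤ (A + B * D) * ∑ v ∈ I, w v := by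
  obtain ⟨I, hI, hmax⟩ := exists_max_image (indepFamily G H) (fun I => ∑ v ∈ I, w v)
    ⟨∅, empty_mem_indepFamily H⟩
  refine ⟨I, hI, ?_⟩
  have := sum_mul_le_of_local_occupancy (w := w) hl hB.le (fun U hU v hv =>
    hardCore_local_occupancy hl hl1 hB hA (fun v hv u hu hvu => by
      refine le_trans ?_ (hd v (hU hv) u (hU hu) hvu)
      gcongr) hld hv) hmax H subset_rfl (fun _ => 1) (fun _ _ => zero_le_one)
    (A + B * D) (by positivity) (fun v hv => by
      rw [sum_const, nsmul_eq_mul, mul_one, mul_one]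
      gcongr
      exact hdeg v hv)
  simpa using this

end HardCore

section Hypergraph

variable {n : ℕ}

/-- The line graph of the complete hypergraph on `Fin n`: distinct intersecting sets are
adjacent. -/
def intersectionGraph (n : ℕ) : SimpleGraph (Finset (Fin n)) where
  Adj e f := e ≠ f ∧ (e ∩ f).Nonempty
  symm := ⟨fun e f h => ⟨h.1.symm, by rw [inter_comm]; exact h.2⟩⟩
  loopless := ⟨fun _ h => h.1 rfl⟩

/-- The members of `U` meeting `f`. -/
noncomputable def edgesMeeting (U : Finset (Finset (Fin n))) (f : Finset (Fin n)) :
    Finset (Finset (Fin n)) :=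
  U.filter fun e => (e ∩ f).Nonempty

lemma LinearHG.vertex_degree_le {H : Finset (Finset (Fin n))} (hH : LinearHG H) {m : ℝ}
    (hm : 2 ≤ m) (hcard : ∀ e ∈ H, m ≤ #e) (x : Fin n) :
    (#(H.filter fun e => x ∈ e) : ℝ) ≤ 2 * n / m := by
  set S := H.filter fun e => x ∈ e with hS
  have hdisj : (S : Set (Finset (Fin n))).PairwiseDisjoint fun e => e.erase x := by
    intro e he f hf hef
    rw [mem_coe, hS, mem_filter] at he hf
    rw [Function.onFun, disjoint_left]
    intro y hy hy'
    rw [mem_erase] at hy hy'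
    have h1 := hH e he.1 f hf.1 hef
    exact hy.1 (card_le_one.1 h1 y (mem_inter.2 ⟨hy.2, hy'.2⟩) x (mem_inter.2 ⟨he.2, hf.2⟩))
  have h1 : ∑ e ∈ S, #(e.erase x) ≤ n := by
    rw [← card_biUnion hdisj]
    simpa using card_le_univ (S.biUnion fun e => e.erase x)
  have h2 : ∀ e ∈ S, m / 2 ≤ (#(e.erase x) : ℝ) := by
    intro e he
    rw [hS, mem_filter] at he
    have h3 : (#(e.erase x) : ℝ) + 1 = #e := by exact_mod_cast card_erase_add_one he.2
    have h4 := hcard e he.1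
    linarith
  have h3 : ∑ _e ∈ S, m / 2 ≤ (n : ℝ) := (sum_le_sum h2).trans (by exact_mod_cast h1)
  rw [sum_const, nsmul_eq_mul] at h3
  rw [le_div_iff₀ (by linarith)]
  linarith

lemma card_edgesMeeting_le {H : Finset (Finset (Fin n))} {δ : ℝ}
    (hdeg : ∀ x, (#(H.filter fun e => x ∈ e) : ℝ) ≤ δ) (f : Finset (Fin n)) :
    (#(edgesMeeting H f) : ℝ) ≤ #f * δ := by
  have hsub : edgesMeeting H f ⊆ f.biUnion fun x => H.filter fun e => x ∈ e := by
    intro e he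
    obtain ⟨heH, x, hx⟩ := mem_filter.1 he
    rw [mem_inter] at hx
    exact mem_biUnion.2 ⟨x, hx.2, mem_filter.2 ⟨heH, hx.1⟩⟩
  calc (#(edgesMeeting H f) : ℝ) ≤ ∑ x ∈ f, (#(H.filter fun e => x ∈ e) : ℝ) := by
        exact_mod_cast (card_le_card hsub).trans card_biUnion_le
    _ ≤ ∑ _x ∈ f, δ := sum_le_sum fun x _ => hdeg x
    _ = #f * δ := by rw [sum_const, nsmul_eq_mul]

lemma LinearHG.codegree_le {H : Finset (Finset (Fin n))} (hH : LinearHG H) {δ R : ℝ}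
    (hdeg : ∀ x, (#(H.filter fun e => x ∈ e) : ℝ) ≤ δ) (hR : ∀ e ∈ H, (#e : ℝ) ≤ R)
    {e f : Finset (Fin n)} (he : e ∈ H) (hf : f ∈ H) (hef : (intersectionGraph n).Adj e f) :
    (#(H.filter fun g => (intersectionGraph n).Adj e g ∧ (intersectionGraph n).Adj f g) : ℝ) ≤
      δ + R ^ 2 := by
  obtain ⟨hne, x, hx⟩ := hef
  have hone := card_le_one.1 (hH e he f hf hne)
  set pairs := (e ×ˢ f).filter fun p => p.1 ≠ p.2 with hpairs
  have hsub : H.filter (fun g => (intersectionGraph n).Adj e g ∧ (intersectionGraph n).Adj f g) ⊆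
      H.filter (fun g => x ∈ g) ∪ pairs.biUnion fun p => H.filter fun g => p.1 ∈ g ∧ p.2 ∈ g := by
    intro g hg
    obtain ⟨hgH, ⟨-, y, hy⟩, ⟨-, z, hz⟩⟩ := mem_filter.1 hg
    rw [mem_inter] at hy hz
    by_cases hyz : y = z
    · have : y = x := hone y (mem_inter.2 ⟨hy.1, hyz ▸ hz.1⟩) x hx
      exact mem_union_left _ (mem_filter.2 ⟨hgH, this ▸ hy.2⟩)
    · refine mem_union_right _ (mem_biUnion.2 ⟨(y, z), ?_, mem_filter.2 ⟨hgH, hy.2, hz.2⟩⟩)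
      exact mem_filter.2 ⟨mem_product.2 ⟨hy.1, hz.1⟩, hyz⟩
  have hpair : ∀ p ∈ pairs, #(H.filter fun g => p.1 ∈ g ∧ p.2 ∈ g) ≤ 1 := by
    intro p hp
    rw [card_le_one]
    intro g hg h hh
    rw [mem_filter] at hg hh hp
    by_contra hgh
    exact hp.2 (card_le_one.1 (hH g hg.1 h hh.1 hgh) _ (mem_inter.2 ⟨hg.2.1, hh.2.1⟩) _
      (mem_inter.2 ⟨hg.2.2, hh.2.2⟩))
  have hcard : #(pairs.biUnion fun p => H.filter fun g => p.1 ∈ g ∧ p.2 ∈ g) ≤ #e * #f := by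
    refine card_biUnion_le.trans ((sum_le_sum hpair).trans ?_)
    rw [sum_const, smul_eq_mul, mul_one, ← card_product]
    exact card_filter_le _ _
  have h1 := (card_le_card hsub).trans (card_union_le _ _)
  have h2 : (#(H.filter fun g => (intersectionGraph n).Adj e g ∧
      (intersectionGraph n).Adj f g) : ℝ) ≤ #(H.filter fun g => x ∈ g) + #e * #f := by
    exact_mod_cast h1.trans (Nat.add_le_add_left hcard _)
  have h3 : (#e : ℝ) * #f ≤ R ^ 2 := by
    rw [sq]
    exact mul_le_mul (hR e he) (hR f hf) (by positivity) ((Nat.cast_nonneg _).trans (hR e he))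
  linarith [hdeg x]

lemma disjoint_of_mem_indepFamily {U M : Finset (Finset (Fin n))}
    (hM : M ∈ indepFamily (intersectionGraph n) U) {e f : Finset (Fin n)} (he : e ∈ M)
    (hf : f ∈ M) (hef : e ≠ f) : ¬ (e ∩ f).Nonempty :=
  fun h => (mem_indepFamily.1 hM).2 e he f hf ⟨hef, h⟩

lemma card_edgesMeeting_le_of_indep {U M : Finset (Finset (Fin n))}
    (hM : M ∈ indepFamily (intersectionGraph n) U) (f : Finset (Fin n)) :
    #(edgesMeeting M f) ≤ #f := by
  have h1 : ((edgesMeeting M f : Finset _) : Set (Finset (Fin n))).PairwiseDisjoint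
      fun e => e ∩ f := by
    intro e he g hg heg
    have he' := (mem_filter.1 (mem_coe.1 he)).1
    have hg' := (mem_filter.1 (mem_coe.1 hg)).1
    have := disjoint_iff_inter_eq_empty.2
      (not_nonempty_iff_eq_empty.1 (disjoint_of_mem_indepFamily hM he' hg' heg))
    exact this.mono inter_subset_left inter_subset_left
  refine (card_le_card_biUnion h1 fun e he => (mem_filter.1 he).2).trans (card_le_card ?_)
  exact biUnion_subset.2 fun e _ => inter_subset_right

lemma ChromIndexLE.of_sdiff {U M : Finset (Finset (Fin n))}
    (hM : M ∈ indepFamily (intersectionGraph n) U) {k : ℕ} (h : ChromIndexLE (U \ M) k) :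
    ChromIndexLE U (k + 1) := by
  obtain ⟨φ, hφ, hprop⟩ := h
  refine ⟨fun e => if e ∈ M then k else φ e, fun e he => ?_, fun e he f hf hef hint => ?_⟩
  · dsimp only
    split_ifs with heM
    · exact Nat.lt_succ_self k
    · exact (hφ e (mem_sdiff.2 ⟨he, heM⟩)).trans (Nat.lt_succ_self k)
  · dsimp only
    split_ifs with heM hfM hfM
    · exact absurd hint (disjoint_of_mem_indepFamily hM heM hfM hef)
    · exact (hφ f (mem_sdiff.2 ⟨hf, hfM⟩)).ne'
    · exact (hφ e (mem_sdiff.2 ⟨he, heM⟩)).ne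
    · exact hprop e (mem_sdiff.2 ⟨he, heM⟩) f (mem_sdiff.2 ⟨hf, hfM⟩) hef hint

/-- Greedy edge-colouring. -/
lemma chromIndexLE_of_card_edgesMeeting_le {U : Finset (Finset (Fin n))} {k : ℕ}
    (hne : ∀ e ∈ U, e.Nonempty) (hk : ∀ f ∈ U, #(edgesMeeting U f) ≤ k) : ChromIndexLE U k := by
  induction U using Finset.induction_on with
  | empty => exact ⟨fun _ => 0, by simp, by simp [IsProperEC]⟩
  | insert e U he ih =>
    obtain ⟨φ, hφ, hprop⟩ := ih (fun f hf => hne f (mem_insert_of_mem hf)) fun f hf =>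
      (card_le_card (filter_subset_filter _ (subset_insert e U))).trans
        (hk f (mem_insert_of_mem hf))
    have hlt : #((edgesMeeting U e).image φ) < #(range k) := by
      have h1 : edgesMeeting (insert e U) e = insert e (edgesMeeting U e) := by
        rw [edgesMeeting, filter_insert, if_pos]
        · rfl
        · rw [inter_self]
          exact hne e (mem_insert_self e U)
      have h2 := hk e (mem_insert_self e U)
      have hnot : e ∉ edgesMeeting U e := fun h => he (mem_filter.1 h).1
      rw [h1, card_insert_of_notMem hnot] at h2
      rw [card_range]
      exact card_image_le.trans_lt h2
    obtain ⟨c, hc, hcn⟩ := exists_mem_notMem_of_card_lt_card hlt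
    have hcφ : ∀ f ∈ U, (f ∩ e).Nonempty → c ≠ φ f := fun f hf hfe h =>
      hcn (h ▸ mem_image_of_mem φ (mem_filter.2 ⟨hf, hfe⟩))
    have hold : ∀ f ∈ U, Function.update φ e c f = φ f := fun f hf =>
      Function.update_of_ne (ne_of_mem_of_not_mem hf he) _ _
    refine ⟨Function.update φ e c, fun f hf => ?_, fun f hf g hg hfg hint => ?_⟩
    · rcases mem_insert.1 hf with rfl | hf
      · simpa using hc
      · rw [hold f hf]
        exact hφ f hf
    · rcases mem_insert.1 hf with hfe | hfU <;> rcases mem_insert.1 hg with hge | hgU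
      · exact absurd (hfe.trans hge.symm) hfg
      · rw [hold g hgU, hfe, Function.update_self]
        exact hcφ g hgU (by rwa [inter_comm, ← hfe])
      · rw [hold f hfU, hge, Function.update_self]
        exact (hcφ f hfU (by rwa [← hge])).symm
      · rw [hold f hfU, hold g hgU]
        exact hprop f hfU g hgU hfg hint

/-- The exponential potential controlling the number of members of `U` meeting each edge. -/
noncomputable def degreePotential (H : Finset (Finset (Fin n))) (t : ℝ)
    (U : Finset (Finset (Fin n))) : ℝ :=
  ∑ f ∈ H, Real.exp (t * #(edgesMeeting U f))

lemma exists_matching_degreePotential_le {H : Finset (Finset (Fin n))} {t c T R : ℝ}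
    (ht : 0 < t) (hc : 0 < c) (hT : 0 ≤ T) (htR : t * R ≤ 1) (hR : ∀ f ∈ H, (#f : ℝ) ≤ R)
    (hmatch : ∀ w : Finset (Fin n) → ℝ, ∃ M ∈ indepFamily (intersectionGraph n) H,
      c * ∑ e ∈ H, w e ≤ ∑ e ∈ M, w e)
    {U : Finset (Finset (Fin n))} (hU : U ⊆ H) :
    ∃ M ∈ indepFamily (intersectionGraph n) U, degreePotential H t (U \ M) ≤
      (1 - c * t * T / 2) * degreePotential H t U + c * t * T / 2 * (#H * Real.exp (t * T)) := by
  set D : Finset (Fin n) → ℝ := fun f => #(edgesMeeting U f) with hD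
  let w : Finset (Fin n) → ℝ := fun e => if e ∈ U then
    (∑ f ∈ H, if (e ∩ f).Nonempty then t * Real.exp (t * D f) else 0) else 0
  have hwsum : ∀ M ⊆ U, ∑ e ∈ M, w e =
      ∑ f ∈ H, t * Real.exp (t * D f) * #(edgesMeeting M f) := by
    intro M hM
    have : ∑ e ∈ M, w e = ∑ e ∈ M, ∑ f ∈ H,
        if (e ∩ f).Nonempty then t * Real.exp (t * D f) else 0 :=
      sum_congr rfl fun e he => if_pos (hM he)
    rw [this, sum_comm]
    refine sum_congr rfl fun f _ => ?_
    rw [← sum_filter, sum_const, nsmul_eq_mul, mul_comm, edgesMeeting]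
  obtain ⟨M₀, hM₀, hM₀w⟩ := hmatch w
  set M := M₀ ∩ U with hMdef
  have hM : M ∈ indepFamily (intersectionGraph n) U :=
    mem_indepFamily.2 ⟨inter_subset_right, fun x hx y hy =>
      (mem_indepFamily.1 hM₀).2 x (mem_inter.1 hx).1 y (mem_inter.1 hy).1⟩
  have hMw : c * ∑ e ∈ U, w e ≤ ∑ e ∈ M, w e := by
    have h1 : ∑ e ∈ U, w e = ∑ e ∈ H, w e :=
      sum_subset hU fun e _ he => if_neg he
    have h2 : ∑ e ∈ M, w e = ∑ e ∈ M₀, w e :=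
      sum_subset inter_subset_left fun e he he' => if_neg fun h => he' (mem_inter.2 ⟨he, h⟩)
    rw [h1, h2]
    exact hM₀w
  rw [hwsum U subset_rfl, hwsum M inter_subset_right] at hMw
  refine ⟨M, hM, ?_⟩
  have hstep : ∀ f ∈ H, Real.exp (t * #(edgesMeeting (U \ M) f)) ≤
      Real.exp (t * D f) - t * Real.exp (t * D f) * #(edgesMeeting M f) / 2 := by
    intro f hf
    have h1 : (#(edgesMeeting (U \ M) f) : ℝ) + #(edgesMeeting M f) = D f := by
      have : edgesMeeting (U \ M) f = edgesMeeting U f \ edgesMeeting M f := by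
        ext e
        simp only [edgesMeeting, mem_filter, mem_sdiff]
        tauto
      have hsub : edgesMeeting M f ⊆ edgesMeeting U f :=
        filter_subset_filter _ inter_subset_right
      rw [this]
      simp only [hD]
      exact_mod_cast card_sdiff_add_card_eq_card hsub
    set s : ℝ := t * #(edgesMeeting M f) with hs
    have hs0 : 0 ≤ s := by positivity
    have hs1 : s ≤ 1 := by
      have : (#(edgesMeeting M f) : ℝ) ≤ R :=
        le_trans (by exact_mod_cast card_edgesMeeting_le_of_indep hM f) (hR f hf)
      exact (mul_le_mul_of_nonneg_left this ht.le).trans htR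
    have h2 : Real.exp (-s) ≤ 1 - s / 2 := by
      rw [Real.exp_neg, inv_le_comm₀ (Real.exp_pos s) (by linarith)]
      refine le_trans ?_ (Real.add_one_le_exp s)
      rw [inv_le_iff_one_le_mul₀ (by linarith)]
      nlinarith
    have h3 : t * #(edgesMeeting (U \ M) f) = t * D f + -s := by
      rw [← h1, hs]; ring
    rw [h3, Real.exp_add]
    have h4 := mul_le_mul_of_nonneg_left h2 (Real.exp_pos (t * D f)).le
    refine h4.trans (le_of_eq ?_)
    rw [hs]; ring
  have hthr : ∀ f ∈ H, Real.exp (t * D f) - c * (t * Real.exp (t * D f) * D f) / 2 ≤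
      (1 - c * t * T / 2) * Real.exp (t * D f) + c * t * T / 2 * Real.exp (t * T) := by
    intro f _
    have hE := Real.exp_pos (t * D f)
    rcases le_total T (D f) with h | h
    · have h1 : c * t * Real.exp (t * D f) * T ≤ c * t * Real.exp (t * D f) * D f := by gcongr
      have h2 : 0 ≤ c * t * T / 2 * Real.exp (t * T) := by positivity
      linarith
    · have h1 : c * t * T / 2 * Real.exp (t * D f) ≤ c * t * T / 2 * Real.exp (t * T) := by
        gcongr
      have h2 : 0 ≤ c * (t * Real.exp (t * D f) * D f) := by positivity
      linarith
  have hsum1 := sum_le_sum hstep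
  have hsum2 := sum_le_sum hthr
  rw [sum_sub_distrib, ← sum_div] at hsum1
  rw [sum_sub_distrib, ← sum_div, ← mul_sum, sum_add_distrib, ← mul_sum, sum_const,
    nsmul_eq_mul] at hsum2
  simp only [degreePotential]
  have : ∀ f, (#(edgesMeeting U f) : ℝ) = D f := fun _ => rfl
  simp only [this] at hMw ⊢
  linarith

lemma exists_uncovered_degreePotential_le {H : Finset (Finset (Fin n))} {t c T R : ℝ}
    (ht : 0 < t) (hc : 0 < c) (hT : 0 ≤ T) (htR : t * R ≤ 1) (hR : ∀ f ∈ H, (#f : ℝ) ≤ R)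
    (hmatch : ∀ w : Finset (Fin n) → ℝ, ∃ M ∈ indepFamily (intersectionGraph n) H,
      c * ∑ e ∈ H, w e ≤ ∑ e ∈ M, w e)
    (hρ : c * t * T / 2 ≤ 1) (q : ℕ) :
    ∃ U ⊆ H, degreePotential H t U ≤
        (1 - c * t * T / 2) ^ q * degreePotential H t H + #H * Real.exp (t * T) ∧
      ∀ k, ChromIndexLE U k → ChromIndexLE H (q + k) := by
  induction q with
  | zero =>
    refine ⟨H, subset_rfl, ?_, fun k hk => by simpa using hk⟩
    rw [pow_zero, one_mul]
    exact le_add_of_nonneg_right (by positivity)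
  | succ q ih =>
    obtain ⟨U, hU, hpot, hcol⟩ := ih
    obtain ⟨M, hM, hMpot⟩ := exists_matching_degreePotential_le ht hc hT htR hR hmatch hU
    refine ⟨U \ M, sdiff_subset.trans hU, hMpot.trans ?_, fun k hk => ?_⟩
    · have := mul_le_mul_of_nonneg_left hpot (sub_nonneg.2 hρ)
      rw [pow_succ]
      linarith
    · have := hcol (k + 1) (ChromIndexLE.of_sdiff hM hk)
      rwa [show q + 1 + k = q + (k + 1) by ring]

/-- If every weighting of `H` admits a matching of large weight, then few matchings cover
all of `H` but a subhypergraph of small line degree. -/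
lemma chromIndexLE_of_weighted_matchings {H : Finset (Finset (Fin n))} {t c T R D : ℝ} {q : ℕ}
    (ht : 0 < t) (hc : 0 < c) (hT : 0 ≤ T) (htR : t * R ≤ 1) (hR : ∀ f ∈ H, (#f : ℝ) ≤ R)
    (hmatch : ∀ w : Finset (Fin n) → ℝ, ∃ M ∈ indepFamily (intersectionGraph n) H,
      c * ∑ e ∈ H, w e ≤ ∑ e ∈ M, w e)
    (hρ : c * t * T / 2 ≤ 1) (hne : ∀ e ∈ H, e.Nonempty)
    (hD : ∀ f ∈ H, (#(edgesMeeting H f) : ℝ) ≤ D) (hq : D ≤ c * T / 2 * q)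
    (hH : 2 * #H ≤ Real.exp (t * T)) :
    ChromIndexLE H (q + ⌊2 * T⌋₊) := by
  obtain ⟨U, hU, hpot, hcol⟩ :=
    exists_uncovered_degreePotential_le ht hc hT htR hR hmatch hρ q
  refine hcol _ (chromIndexLE_of_card_edgesMeeting_le (fun e he => hne e (hU he)) fun f hf => ?_)
  have hΦ0 : degreePotential H t H ≤ #H * Real.exp (t * D) := by
    rw [← nsmul_eq_mul]
    refine sum_le_card_nsmul _ _ _ fun f hf => ?_
    gcongr
    exact hD f hf
  have hpow : (1 - c * t * T / 2) ^ q ≤ Real.exp (-(t * D)) := by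
    calc (1 - c * t * T / 2) ^ q ≤ Real.exp (-(c * t * T / 2)) ^ q := by
          refine pow_le_pow_left₀ (sub_nonneg.2 hρ) ?_ q
          have := Real.add_one_le_exp (-(c * t * T / 2))
          linarith
      _ = Real.exp (q * -(c * t * T / 2)) := (Real.exp_nat_mul _ _).symm
      _ ≤ Real.exp (-(t * D)) := by
          gcongr
          have := mul_le_mul_of_nonneg_left hq ht.le
          linarith
  have hfirst : (1 - c * t * T / 2) ^ q * degreePotential H t H ≤ #H := by
    calc _ ≤ Real.exp (-(t * D)) * (#H * Real.exp (t * D)) := by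
          gcongr
          exact sum_nonneg fun _ _ => (Real.exp_pos _).le
      _ = #H := by
          rw [mul_left_comm, ← Real.exp_add, neg_add_cancel, Real.exp_zero, mul_one]
  have hone : (1 : ℝ) ≤ Real.exp (t * T) := Real.one_le_exp (by positivity)
  have hle : Real.exp (t * #(edgesMeeting U f)) ≤ degreePotential H t U :=
    single_le_sum (f := fun f => Real.exp (t * #(edgesMeeting U f)))
      (fun _ _ => (Real.exp_pos _).le) (hU hf)
  have hH0 : (0 : ℝ) ≤ #H := Nat.cast_nonneg _
  have hfin : Real.exp (t * #(edgesMeeting U f)) ≤ Real.exp (t * (2 * T)) := by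
    calc _ ≤ #H + #H * Real.exp (t * T) := by linarith
      _ ≤ 2 * #H * Real.exp (t * T) := by nlinarith
      _ ≤ Real.exp (t * T) * Real.exp (t * T) := by gcongr
      _ = Real.exp (t * (2 * T)) := by rw [← Real.exp_add]; ring_nf
  rw [Real.exp_le_exp] at hfin
  exact Nat.le_floor (le_of_mul_le_mul_left hfin ht)

end Hypergraph

section SparseHypergraph

variable {n : ℕ}

lemma LinearHG.exists_matching_large_weight {H : Finset (Finset (Fin n))} (hH : LinearHG H)
    {m R C K l : ℝ} (hn : 0 < n) (hm : 2 ≤ m) (hmcard : ∀ e ∈ H, m ≤ #e)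
    (hR : ∀ e ∈ H, (#e : ℝ) ≤ R) (hC : 0 < C) (hRm : 2 * R / m ≤ C) (hK : 0 < K)
    (hl : l = 2 * K * (1 + Real.exp (4 * (2 * C * K)))) (hln : l ≤ n)
    (hsparse : l / n * (2 * n / m + R ^ 2 + 1) ≤ 1 / 2) (w : Finset (Fin n) → ℝ) :
    ∃ M ∈ indepFamily (intersectionGraph n) H, K / n * ∑ e ∈ H, w e ≤ ∑ e ∈ M, w e := by
  have hn' : (0 : ℝ) < n := by exact_mod_cast hn
  have hl0 : 0 < l := by rw [hl]; positivity
  have hdeg := hH.vertex_degree_le hm hmcard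
  obtain ⟨M, hM, hMw⟩ := exists_indep_large_weight (G := intersectionGraph n) (H := H)
    (l := l / n) (d := 2 * n / m + R ^ 2) (D := C * n) (A := n / (2 * K))
    (B := 1 / (2 * C * K)) (by positivity) ((div_le_one hn').2 hln) (by positivity)
    (by positivity) (by positivity)
    (by
      rw [hl, div_div_eq_mul_div, div_one]
      refine le_of_eq ?_
      field_simp)
    (fun e he => by
      have h1 : H.filter (fun x => (intersectionGraph n).Adj e x) ⊆ edgesMeeting H e := by
        intro x hx
        rw [mem_filter] at hx
        exact mem_filter.2 ⟨hx.1, hx.2.symm.2⟩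
      calc (#(H.filter fun x => (intersectionGraph n).Adj e x) : ℝ) ≤ #(edgesMeeting H e) := by
            exact_mod_cast card_le_card h1
        _ ≤ #e * (2 * n / m) := card_edgesMeeting_le hdeg e
        _ ≤ R * (2 * n / m) := by
            gcongr
            exact hR e he
        _ = 2 * R / m * n := by ring
        _ ≤ C * n := by gcongr)
    (fun e he f hf hef => hH.codegree_le hdeg hR he hf hef) hsparse w
  refine ⟨M, hM, ?_⟩
  have hsum : (n : ℝ) / (2 * K) + 1 / (2 * C * K) * (C * n) = n / K := by
    field_simp
    norm_num
  rw [hsum] at hMw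
  calc K / n * ∑ e ∈ H, w e ≤ K / n * (n / K * ∑ e ∈ M, w e) := by gcongr
    _ = ∑ e ∈ M, w e := by field_simp

lemma LinearHG.card_le_sq {H : Finset (Finset (Fin n))} (hH : LinearHG H)
    (hcard : ∀ e ∈ H, (2 : ℝ) ≤ #e) : (#H : ℝ) ≤ n ^ 2 := by
  have h1 := card_edgesMeeting_le (hH.vertex_degree_le le_rfl hcard) univ
  have h2 : edgesMeeting H univ = H := by
    refine filter_true_of_mem fun e he => ?_
    rw [inter_univ, ← card_pos]
    have := hcard e he
    exact_mod_cast zero_lt_two.trans_le this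
  rw [h2, card_univ, Fintype.card_fin] at h1
  refine h1.trans (le_of_eq ?_)
  ring

lemma two_mul_sq_le_exp {a : ℝ} (ha : 0 < a) {x : ℝ} (hx : 1440 / a ^ 6 ≤ x) :
    2 * x ^ 2 ≤ Real.exp (a * √x) := by
  have hx0 : 0 ≤ x := le_trans (by positivity) hx
  have h1 := Real.pow_div_factorial_le_exp (a * √x) (by positivity) 6
  refine le_trans ?_ h1
  have h2 : (a * √x) ^ 6 = a ^ 6 * x * x ^ 2 := by
    rw [mul_pow, show √x ^ 6 = (√x ^ 2) ^ 3 by ring, Real.sq_sqrt hx0]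
    ring
  have h3 : 1440 ≤ a ^ 6 * x := by
    rw [div_le_iff₀ (by positivity)] at hx
    linarith
  rw [h2, show ((Nat.factorial 6 : ℕ) : ℝ) = 720 by norm_num [Nat.factorial],
    le_div_iff₀ (by norm_num)]
  have := mul_le_mul_of_nonneg_right h3 (sq_nonneg x)
  linarith

end SparseHypergraph

/-- An `n`-vertex linear hypergraph whose edge sizes all lie in `[1/η, η√n]` and with
`min |e| ≥ α · max |e|` has chromatic index at most `εn`. -/
theorem chrom_index_of_very_sparse :
    ∀ α ε : ℝ, 0 < α → α < 1 → 0 < ε → ε < 1 →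
      ∃ η0 : ℝ, 0 < η0 ∧ ∀ η : ℝ, 0 < η → η ≤ η0 →
        ∃ n0 : ℕ, ∀ n : ℕ, n0 ≤ n →
          ∀ H : Finset (Finset (Fin n)), LinearHG H →
            (∀ e ∈ H, 1 / η ≤ (e.card : ℝ) ∧ (e.card : ℝ) ≤ η * Real.sqrt n) →
            (∀ e ∈ H, ∀ f ∈ H, α * (f.card : ℝ) ≤ (e.card : ℝ)) →
            ∃ k : ℕ, (k : ℝ) ≤ ε * n ∧ ChromIndexLE H k := by
  intro α ε hα _ hε _
  set K : ℝ := 64 / (α * ε ^ 2) with hK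
  set C : ℝ := 2 / α with hC
  have hK0 : 0 < K := by positivity
  have hC0 : 0 < C := by positivity
  set l : ℝ := 2 * K * (1 + Real.exp (4 * (2 * C * K))) with hl
  have hl0 : 0 < l := by positivity
  refine ⟨min (1 / 2) (1 / (12 * l)), by positivity, fun η hη hη0 => ?_⟩
  have hη2 : η ≤ 1 / 2 := hη0.trans (min_le_left _ _)
  have hηl : 12 * l * η ≤ 1 := by
    have := hη0.trans (min_le_right _ _)
    rw [le_div_iff₀ (by positivity)] at this
    linarith
  set s : ℝ := K * ε / (8 * η) with hs
  refine ⟨⌈4 * l + 4 / ε + s ^ 2 + 1440 / (ε / 4) ^ 6⌉₊, fun n hn H hH hcard hratio => ?_⟩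
  rw [Nat.ceil_le] at hn
  have hb1 : 0 < 4 / ε := by positivity
  have hb2 : 0 ≤ s ^ 2 := sq_nonneg s
  have hb3 : 0 < 1440 / (ε / 4) ^ 6 := by positivity
  have hn0 : (0 : ℝ) < n := by linarith
  have hn0' : 0 < n := by exact_mod_cast hn0
  have hsq : 0 < √(n : ℝ) := Real.sqrt_pos.2 hn0
  rcases H.eq_empty_or_nonempty with rfl | hne
  · exact ⟨0, by simpa using by positivity, fun _ => 0, by simp, by simp [IsProperEC]⟩
  obtain ⟨e₀, he₀, hmin⟩ := exists_min_image H card hne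
  set m : ℝ := (#e₀ : ℝ)
  set R : ℝ := η * √(n : ℝ) with hR
  have hR0 : 0 < R := by positivity
  have hηm : 1 ≤ η * m := by
    have := (hcard e₀ he₀).1
    rwa [div_le_iff₀' hη] at this
  have hm2 : 2 ≤ m := by nlinarith
  have hm0 : 0 < m := by linarith
  have hmcard : ∀ e ∈ H, m ≤ #e := fun e he => Nat.cast_le.2 (hmin e he)
  obtain ⟨e₁, he₁, hmax⟩ := exists_max_image H card hne
  have hRe₁ : (#e₁ : ℝ) ≤ R := (hcard e₁ he₁).2
  have hRmax : ∀ e ∈ H, (#e : ℝ) ≤ #e₁ := fun e he => by exact_mod_cast hmax e he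
  have hRm : 2 * (#e₁ : ℝ) / m ≤ C := by
    rw [hC, div_le_div_iff₀ hm0 hα]
    linarith [hratio e₀ he₀ e₁ he₁]
  have hmatch := hH.exists_matching_large_weight hn0' hm2 hmcard hRmax hC0 hRm hK0 hl
    (by linarith) (by
      have h1 : 2 * n / m ≤ 2 * η * n := by
        rw [div_le_iff₀ hm0]
        nlinarith
      have h2 : (#e₁ : ℝ) ^ 2 ≤ η * n := by
        calc (#e₁ : ℝ) ^ 2 ≤ R ^ 2 := by gcongr
          _ = η * (η * n) := by rw [hR, mul_pow, Real.sq_sqrt hn0.le]; ring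
          _ ≤ 1 * (η * n) := by gcongr; linarith
          _ = η * n := one_mul _
      calc l / n * (2 * n / m + (#e₁ : ℝ) ^ 2 + 1) ≤ l / n * (2 * η * n + η * n + 1) := by gcongr
        _ = (12 * l * η) / 4 + l / n := by field_simp; ring
        _ ≤ 1 / 4 + 1 / 4 := by
            have h3 : l / n ≤ 1 / 4 := by
              rw [div_le_iff₀ hn0]
              linarith
            linarith
        _ = 1 / 2 := by norm_num)
  have hT : 0 < ε * n / 4 := by positivity
  have hεn : 4 ≤ ε * n := by
    have : 4 / ε ≤ n := by linarith
    rw [div_le_iff₀ hε] at this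
    linarith
  have hfloor : ε * n / 4 ≤ (⌊ε * n / 2⌋₊ : ℝ) := by
    have := Nat.lt_floor_add_one (ε * n / 2)
    linarith
  have hsn : s ≤ √(n : ℝ) := Real.le_sqrt_of_sq_le (by linarith)
  have hmain := chromIndexLE_of_weighted_matchings (H := H) (t := 1 / R) (c := K / n)
    (T := ε * n / 4) (R := R) (D := C * n) (q := ⌊ε * n / 2⌋₊) (by positivity) (by positivity)
    hT.le (by rw [one_div_mul_cancel hR0.ne']) (fun e he => (hcard e he).2) hmatch
    (by
      have h1 : K / n * (1 / R) * (ε * n / 4) / 2 = s / √(n : ℝ) := by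
        rw [hs, hR]
        field_simp
        norm_num
      rw [h1]
      exact (div_le_one hsq).2 hsn)
    (fun e he => card_pos.1 (by
      have := hm0.trans_le (hmcard e he)
      exact_mod_cast this))
    (fun e he => by
      calc (#(edgesMeeting H e) : ℝ) ≤ #e * (2 * n / m) :=
            card_edgesMeeting_le (hH.vertex_degree_le hm2 hmcard) e
        _ ≤ #e₁ * (2 * n / m) := by
            refine mul_le_mul_of_nonneg_right (hRmax e he) (by positivity)
        _ = 2 * #e₁ / m * n := by ring
        _ ≤ C * n := by gcongr)
    (by
      have h1 : C * n = K / n * (ε * n / 4) / 2 * (ε * n / 4) := by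
        rw [hC, hK]
        field_simp
        norm_num
      rw [h1]
      gcongr)
    (by
      have h1 := hH.card_le_sq fun e he => hm2.trans (hmcard e he)
      have h2 := two_mul_sq_le_exp (a := ε / 4) (by positivity) (x := n) (by linarith)
      have h3 : ε / 4 * √(n : ℝ) ≤ 1 / R * (ε * n / 4) := by
        rw [one_div_mul_eq_div, le_div_iff₀ hR0, hR]
        have h4 : √(n : ℝ) * √(n : ℝ) = n := Real.mul_self_sqrt hn0.le
        calc ε / 4 * √(n : ℝ) * (η * √(n : ℝ)) = η * (ε * n / 4) := by
              linear_combination ε / 4 * η * h4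
          _ ≤ 1 * (ε * n / 4) := by gcongr; linarith
          _ = _ := one_mul _
      have h4 := Real.exp_le_exp.2 h3
      linarith)
  refine ⟨_, ?_, hmain⟩
  have h1 : (⌊ε * n / 2⌋₊ : ℝ) ≤ ε * n / 2 := Nat.floor_le (by positivity)
  have h2 : (⌊2 * (ε * n / 4)⌋₊ : ℝ) ≤ 2 * (ε * n / 4) := Nat.floor_le (by positivity)
  push_cast
  linarith
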